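/- Fix k ≥ 3. Let Δ'_k = ℤ/2ℤ * ℤ/2ℤ = ⟨a,b | a² = b² = 1⟩ with generating set T'_k consisting of all elements represented by alternating words in a,b of length ℓ with 2 ≤ ℓ ≤ 2k-3, i.e. T'_k = {(ab)^j, (ba)^j : 1 ≤ j ≤ k-2} ∪ {(ab)^j a, (ba)^j b : 1 ≤ j ≤ k-2}. Then the Borel chromatic number of the shift graph of (Δ'_k,T'_k) equals k+1. -/

import Mathlib

open Multiplicative

section Defs

variable {G : Type*} [Group G]

/-- The left shift action of `g : G` on `x : G → Bool` (`2^G` with `2 = Bool`):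
`(g · x)(h) = x (g⁻¹ h)`. -/
def shiftMap (g : G) (x : G → Bool) : G → Bool := fun h => x (g⁻¹ * h)

/-- The free part `F(2^G)` of the left shift action. -/
def FreePart (G : Type*) [Group G] : Set (G → Bool) :=
  {x | ∀ g : G, g ≠ 1 → shiftMap g x ≠ x}

/-- Adjacency in the shift graph of the marked group `(G, S)`: distinct `x, y ∈ F(2^G)`
are adjacent iff `y = s · x` for some `s ∈ S`. -/
def ShiftAdj (S : Set G) (x y : FreePart G) : Prop :=
  x ≠ y ∧ ∃ s ∈ S, (y : G → Bool) = shiftMap s (x : G → Bool)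

/-- Adjacency in the Cayley graph of `(G, S)`: distinct `g, h` are adjacent iff
`h = s * g` for some `s ∈ S`. -/
def CayleyAdj (S : Set G) (g h : G) : Prop :=
  g ≠ h ∧ ∃ s ∈ S, h = s * g

/-- `(G, S)` is a marked group: `S` is a finite symmetric generating set
not containing the identity. -/
def IsMarkedGroup (S : Set G) : Prop :=
  S.Finite ∧ (∀ s ∈ S, s⁻¹ ∈ S) ∧ (1 : G) ∉ S ∧ Subgroup.closure S = ⊤

end Defs

/-- A graph (given by its adjacency relation) has an `n`-coloring. -/
def HasColoring {X : Type*} (Adj : X → X → Prop) (n : ℕ) : Prop :=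
  ∃ c : X → Fin n, ∀ x y, Adj x y → c x ≠ c y

/-- The chromatic number: the least `n` admitting an `n`-coloring. -/
noncomputable def chromatic {X : Type*} (Adj : X → X → Prop) : ℕ :=
  sInf {n | HasColoring Adj n}

/-- A graph on a measurable space has a Borel `n`-coloring. -/
def HasBorelColoring {X : Type*} [MeasurableSpace X] (Adj : X → X → Prop) (n : ℕ) : Prop :=
  ∃ c : X → Fin n, Measurable c ∧ ∀ x y, Adj x y → c x ≠ c y

/-- The Borel chromatic number: the least `n` admitting a Borel `n`-coloring. -/
noncomputable def borelChromatic {X : Type*} [MeasurableSpace X] (Adj : X → X → Prop) : ℕ :=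
  sInf {n | HasBorelColoring Adj n}
open Monoid in
/-- The free product `ℤ/2ℤ * ℤ/2ℤ = ⟨a, b ∣ a² = b² = 1⟩`. -/
abbrev D2 : Type := Monoid.Coprod (Multiplicative (ZMod 2)) (Multiplicative (ZMod 2))

/-- The generator `a` of the first factor of `ℤ/2ℤ * ℤ/2ℤ`. -/
def genA : D2 := Monoid.Coprod.inl (ofAdd (1 : ZMod 2))

/-- The generator `b` of the second factor of `ℤ/2ℤ * ℤ/2ℤ`. -/
def genB : D2 := Monoid.Coprod.inr (ofAdd (1 : ZMod 2))

/-- The generating set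
`T'_k = {(ab)^j, (ba)^j : 1 ≤ j ≤ k-2} ∪ {(ab)^j a, (ba)^j b : 1 ≤ j ≤ k-2}`,
i.e. all alternating words in `a, b` of length `ℓ` with `2 ≤ ℓ ≤ 2k - 3`. -/
def TK' (k : ℕ) : Set D2 :=
  {x | ∃ j : ℕ, 1 ≤ j ∧ j ≤ k - 2 ∧
    (x = (genA * genB) ^ j ∨ x = (genB * genA) ^ j ∨
     x = (genA * genB) ^ j * genA ∨ x = (genB * genA) ^ j * genB)}


/-! ### Combinatorics of `k`-colorings of a line -/

theorem lb_fiber_card {k : ℕ} (hk : 3 ≤ k) (C : ℤ → Fin k)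
    (h : ∀ i j : ℤ, 2 ≤ j - i → j - i ≤ 2 * k - 3 → C i ≠ C j) (s : ℤ) (p : Fin k) :
    ((Finset.Icc s (s + 2 * k - 2)).filter (fun i => C i = p)).card ≤ 2 := by
  by_contra hc
  push Not at hc
  obtain ⟨a, ha, b, hb, c, hc, hab, hac, hbc⟩ := Finset.two_lt_card.1 hc
  simp only [Finset.mem_filter, Finset.mem_Icc] at ha hb hc
  have key : ∀ i j : ℤ, C i = p → C j = p → ¬ (2 ≤ j - i ∧ j - i ≤ 2 * k - 3) :=
    fun i j hi hj hh => h i j hh.1 hh.2 (hi.trans hj.symm)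
  have h1 := key a b ha.2 hb.2
  have h2 := key b a hb.2 ha.2
  have h3 := key a c ha.2 hc.2
  have h4 := key c a hc.2 ha.2
  have h5 := key b c hb.2 hc.2
  have h6 := key c b hc.2 hb.2
  omega

theorem lb_sum {k : ℕ} (hk : 3 ≤ k) (C : ℤ → Fin k) (s : ℤ) :
    ∑ p : Fin k, ((Finset.Icc s (s + 2 * k - 2)).filter (fun i => C i = p)).card = 2 * k - 1 := by
  rw [← Finset.card_eq_sum_card_fiberwise (fun _ _ => Finset.mem_coe.2 (Finset.mem_univ _))]
  rw [Int.card_Icc]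
  omega

theorem lb_all {k : ℕ} (hk : 3 ≤ k) (C : ℤ → Fin k)
    (h : ∀ i j : ℤ, 2 ≤ j - i → j - i ≤ 2 * k - 3 → C i ≠ C j) (s : ℤ) (p : Fin k) :
    ∃ i, s ≤ i ∧ i ≤ s + 2 * k - 2 ∧ C i = p := by
  by_contra hc
  push Not at hc
  have h0 : ((Finset.Icc s (s + 2 * k - 2)).filter (fun i => C i = p)).card = 0 := by
    rw [Finset.card_eq_zero, Finset.filter_eq_empty_iff]
    intro i hi
    rw [Finset.mem_Icc] at hi
    exact hc i hi.1 hi.2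
  have hs := lb_sum hk C s
  rw [← Finset.add_sum_erase _ _ (Finset.mem_univ p), h0] at hs
  have := Finset.sum_le_card_nsmul (Finset.univ.erase p)
    (fun p => ((Finset.Icc s (s + 2 * k - 2)).filter (fun i => C i = p)).card) 2
    (fun q _ => lb_fiber_card hk C h s q)
  rw [Finset.card_erase_of_mem (Finset.mem_univ _), Finset.card_univ, Fintype.card_fin] at this
  simp only [smul_eq_mul] at this
  omega

theorem lb_two {k : ℕ} (hk : 3 ≤ k) (C : ℤ → Fin k)
    (h : ∀ i j : ℤ, 2 ≤ j - i → j - i ≤ 2 * k - 3 → C i ≠ C j) (s : ℤ) (p q : Fin k) (hpq : p ≠ q)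
    (u v : ℤ)
    (hp : ∀ i, s ≤ i → i ≤ s + 2 * k - 2 → C i = p → i = u)
    (hq : ∀ i, s ≤ i → i ≤ s + 2 * k - 2 → C i = q → i = v) : False := by
  have h1 : ((Finset.Icc s (s + 2 * k - 2)).filter (fun i => C i = p)).card ≤ 1 := by
    rw [Finset.card_le_one]
    intro a ha b hb
    simp only [Finset.mem_filter, Finset.mem_Icc] at ha hb
    rw [hp a ha.1.1 ha.1.2 ha.2, hp b hb.1.1 hb.1.2 hb.2]
  have h2 : ((Finset.Icc s (s + 2 * k - 2)).filter (fun i => C i = q)).card ≤ 1 := by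
    rw [Finset.card_le_one]
    intro a ha b hb
    simp only [Finset.mem_filter, Finset.mem_Icc] at ha hb
    rw [hq a ha.1.1 ha.1.2 ha.2, hq b hb.1.1 hb.1.2 hb.2]
  have hs := lb_sum hk C s
  have hq' : q ∈ Finset.univ.erase p := Finset.mem_erase.2 ⟨hpq.symm, Finset.mem_univ _⟩
  rw [← Finset.add_sum_erase _ _ (Finset.mem_univ p), ← Finset.add_sum_erase _ _ hq'] at hs
  have := Finset.sum_le_card_nsmul ((Finset.univ.erase p).erase q)
    (fun p => ((Finset.Icc s (s + 2 * k - 2)).filter (fun i => C i = p)).card) 2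
    (fun q _ => lb_fiber_card hk C h s q)
  rw [Finset.card_erase_of_mem hq', Finset.card_erase_of_mem (Finset.mem_univ _),
    Finset.card_univ, Fintype.card_fin] at this
  simp only [smul_eq_mul] at this
  omega

theorem lb_next {k : ℕ} (hk : 3 ≤ k) (C : ℤ → Fin k)
    (h : ∀ i j : ℤ, 2 ≤ j - i → j - i ≤ 2 * k - 3 → C i ≠ C j) (p q : Fin k) (hpq : p ≠ q)
    (n : ℤ) (hp : C n = p) (hq : C (n + 1) = q) :
    ∃ n', n < n' ∧ C n' = p ∧ C (n' + 1) = q ∧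
      ∀ m, n ≤ m → m < n' → ¬ (C m = q ∧ C (m + 1) = p) := by
  have key : ∀ i j : ℤ, C i = C j → ¬ (2 ≤ j - i ∧ j - i ≤ 2 * k - 3) :=
    fun i j hi hh => h i j hh.1 hh.2 hi
  -- where `p` and `q` can occur
  have occp : ∀ i, n < i → i < n + 2 * k - 2 → C i ≠ p := by
    intro i h1 h2 hi
    by_cases e : i = n + 1
    · rw [e, hq] at hi; exact hpq hi.symm
    · exact key n i (hp.trans hi.symm) (by omega)
  have occq : ∀ i, n + 2 < i → i < n + 2 * k - 1 → C i ≠ q := by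
    intro i h1 h2 hi
    exact key (n + 1) i (hq.trans hi.symm) (by omega)
  have occq2 : C (n + 2) = q → C (n + 2 * k - 1) ≠ q := by
    intro h1 h2
    exact key (n + 2) _ (h1.trans h2.symm) (by omega)
  have noqp : ∀ m, n ≤ m → m < n + 2 * k - 1 → ¬ (C m = q ∧ C (m + 1) = p) := by
    rintro m h1 h2 ⟨h3, h4⟩
    by_cases e : m = n
    · rw [e, hp] at h3; exact hpq h3
    · have : ¬ (m + 1 < n + 2 * k - 2) := fun hh => occp (m + 1) (by omega) hh h4
      exact occq m (by omega) (by omega) h3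
  by_cases e1 : C (n + 2 * k - 1) = p
  · by_cases e2 : C (n + 2 * k) = q
    · exact ⟨n + 2 * k - 1, by omega, e1, by rw [← e2]; congr 1; ring, noqp⟩
    · -- `q` occurs at `n + 2`
      have e3 : C (n + 2) = q := by
        obtain ⟨i, h1, h2, h3⟩ := lb_all hk C h (n + 2) q
        by_contra hne
        have a1 : i ≠ n + 2 := by rintro rfl; exact hne h3
        have a2 : i ≠ n + 2 * k := by rintro rfl; exact e2 h3
        have a3 : i ≠ n + 2 * k - 1 := by rintro rfl; exact hpq (e1.symm.trans h3)
        exact occq i (by omega) (by omega) h3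
      have e4 : C (n + 2 * k) = p := by
        by_contra hne
        refine lb_two hk C h (n + 2) q (C (n + 2 * k)) (Ne.symm e2) (n + 2) (n + 2 * k) ?_ ?_
        · intro i h1 h2 h3
          by_contra a1
          have a2 : i ≠ n + 2 * k := by rintro rfl; exact e2 h3
          have a3 : i ≠ n + 2 * k - 1 := by rintro rfl; exact hpq (e1.symm.trans h3)
          exact occq i (by omega) (by omega) h3
        · intro i h1 h2 h3
          by_contra a1
          have a2 : i ≠ n + 2 * k - 1 := by rintro rfl; exact hne (h3.symm.trans e1)
          have a3 : i ≠ n + 2 := by rintro rfl; exact e2 (h3.symm.trans e3)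
          exact key i _ h3 (by omega)
      have e5 : C (n + 2 * k + 1) = q := by
        obtain ⟨i, h1, h2, h3⟩ := lb_all hk C h (n + 3) q
        by_contra hne
        have a1 : i ≠ n + 2 * k + 1 := by rintro rfl; exact hne h3
        have a2 : i ≠ n + 2 * k := by rintro rfl; exact e2 h3
        have a3 : i ≠ n + 2 * k - 1 := by rintro rfl; exact hpq (e1.symm.trans h3)
        exact occq i (by omega) (by omega) h3
      refine ⟨n + 2 * k, by omega, e4, e5, ?_⟩
      rintro m h1 h2 ⟨h3, h4⟩
      by_cases e : m = n + 2 * k - 1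
      · subst e; exact hpq (e1.symm.trans h3)
      · exact noqp m h1 (by omega) ⟨h3, h4⟩
  · have e2 : C (n + 2 * k - 2) = p := by
      obtain ⟨i, h1, h2, h3⟩ := lb_all hk C h (n + 1) p
      have a1 : i ≠ n + 2 * k - 1 := by rintro rfl; exact e1 h3
      have : ¬ (i < n + 2 * k - 2) := fun hh => occp i (by omega) hh h3
      have : i = n + 2 * k - 2 := by omega
      rw [← this]; exact h3
    have e3 : C (n + 2 * k - 1) = q := by
      by_contra hne
      refine lb_two hk C h (n + 1) p (C (n + 2 * k - 1)) (Ne.symm e1)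
        (n + 2 * k - 2) (n + 2 * k - 1) ?_ ?_
      · intro i h1 h2 h3
        by_contra a1
        have a2 : i ≠ n + 2 * k - 1 := by rintro rfl; exact e1 h3
        exact occp i (by omega) (by omega) h3
      · intro i h1 h2 h3
        by_contra a1
        have a2 : i ≠ n + 2 * k - 2 := by rintro rfl; exact e1 (h3.symm.trans e2)
        have a3 : i ≠ n + 1 := by rintro rfl; exact hne (h3.symm.trans hq)
        exact key i _ h3 (by omega)
    exact ⟨n + 2 * k - 2, by omega, e2, by rw [← e3]; congr 1; ring,
      fun m h1 h2 => noqp m h1 (by omega)⟩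

theorem lb_right {k : ℕ} (hk : 3 ≤ k) (C : ℤ → Fin k)
    (h : ∀ i j : ℤ, 2 ≤ j - i → j - i ≤ 2 * k - 3 → C i ≠ C j) (p q : Fin k) (hpq : p ≠ q) :
    ∀ (t : ℕ) (n m : ℤ), m - n = t → C n = p → C (n + 1) = q → C m = q → C (m + 1) = p →
      False := by
  intro t
  induction t using Nat.strong_induction_on with
  | _ t ih =>
    intro n m hmn h1 h2 h3 h4
    obtain ⟨n', a1, a2, a3, a4⟩ := lb_next hk C h p q hpq n h1 h2
    by_cases hm : m < n'
    · exact a4 m (by omega) hm ⟨h3, h4⟩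
    · exact ih (m - n').toNat (by omega) n' m (by omega) a2 a3 h3 h4

theorem lb_antisymm {k : ℕ} (hk : 3 ≤ k) (C : ℤ → Fin k)
    (h : ∀ i j : ℤ, 2 ≤ j - i → j - i ≤ 2 * k - 3 → C i ≠ C j) (p q : Fin k) (hpq : p ≠ q)
    (n m : ℤ) (h1 : C n = p) (h2 : C (n + 1) = q) (h3 : C m = q) (h4 : C (m + 1) = p) : False := by
  rcases le_total n m with hnm | hnm
  · exact lb_right hk C h p q hpq (m - n).toNat n m (by omega) h1 h2 h3 h4
  · exact lb_right hk C h q p hpq.symm (n - m).toNat m n (by omega) h3 h4 h1 h2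

/-! ### Extending colorings of windows -/

theorem ext_chain {D : ℕ} (V : Fin D → Fin (D + 1)) (hV : Function.Injective V) :
    ∀ (m : ℕ) (u : Fin D → Fin (D + 1)), Function.Injective u →
      (Finset.univ.filter (fun i => u i ≠ V i)).card ≤ m →
      ∃ U : ℕ → Fin D → Fin (D + 1), U 0 = u ∧ (∀ t, 2 * m ≤ t → U t = V) ∧
        (∀ t, Function.Injective (U t)) ∧ ∀ t i i', i ≠ i' → U t i ≠ U (t + 1) i' := by
  have const : ∀ m : ℕ, ∃ U : ℕ → Fin D → Fin (D + 1), U 0 = V ∧ (∀ t, 2 * m ≤ t → U t = V) ∧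
        (∀ t, Function.Injective (U t)) ∧ ∀ t i i', i ≠ i' → U t i ≠ U (t + 1) i' :=
    fun m => ⟨fun _ => V, rfl, fun _ _ => rfl, fun _ => hV, fun _ i i' h hh => h (hV hh)⟩
  -- replacing one entry by a missing color
  have upd : ∀ (u : Fin D → Fin (D + 1)), Function.Injective u → ∀ j z, (∀ i, u i ≠ z) →
      Function.Injective (Function.update u j z) ∧
        ∀ i i', i ≠ i' → u i ≠ Function.update u j z i' := by
    intro u hu j z hz
    constructor
    · intro i i' hii
      by_cases h1 : i = j <;> by_cases h2 : i' = j
      · rw [h1, h2]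
      · subst h1; simp [Function.update_of_ne h2] at hii; exact absurd hii.symm (hz i')
      · subst h2; simp [Function.update_of_ne h1] at hii; exact absurd hii (hz i)
      · rw [Function.update_of_ne h1, Function.update_of_ne h2] at hii; exact hu hii
    · intro i i' hii
      by_cases h2 : i' = j
      · subst h2; simpa using hz i
      · rw [Function.update_of_ne h2]; exact fun hh => hii (hu hh)
  intro m
  induction m with
  | zero =>
    intro u hu hc
    have : u = V := by
      funext i
      by_contra hne
      have : i ∈ Finset.univ.filter (fun i => u i ≠ V i) := by simp [hne]
      rw [Finset.card_eq_zero.1 (Nat.le_zero.1 hc)] at this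
      simp at this
    subst this
    exact const 0
  | succ m ih =>
    intro u hu hc
    by_cases huV : u = V
    · subst huV; exact const _
    obtain ⟨i, hi⟩ := Function.ne_iff.1 huV
    -- two moves
    obtain ⟨u1, u2, hu1, hu2, c1, c2, hc2⟩ : ∃ u1 u2 : Fin D → Fin (D + 1),
        Function.Injective u1 ∧ Function.Injective u2 ∧ (∀ i i', i ≠ i' → u i ≠ u1 i') ∧
        (∀ i i', i ≠ i' → u1 i ≠ u2 i') ∧
        (Finset.univ.filter (fun i => u2 i ≠ V i)).card ≤ m := by
      have cnt : ∀ u2 : Fin D → Fin (D + 1), u2 i = V i → (∀ l, u l = V l → u2 l = V l) →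
          (Finset.univ.filter (fun i => u2 i ≠ V i)).card ≤ m := by
        intro u2 h1 h2
        have : (Finset.univ.filter (fun i => u2 i ≠ V i)).card <
            (Finset.univ.filter (fun i => u i ≠ V i)).card := by
          apply Finset.card_lt_card
          rw [Finset.ssubset_iff_of_subset]
          · exact ⟨i, by simp [hi], by simp [h1]⟩
          · intro l
            simp only [Finset.mem_filter, Finset.mem_univ, true_and]
            exact fun hl hh => hl (h2 l hh)
        omega
      by_cases hmiss : ∃ j, u j = V i
      · obtain ⟨j, hj⟩ := hmiss
        have hij : j ≠ i := by rintro rfl; exact hi hj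
        obtain ⟨z, hz⟩ : ∃ z, ∀ i, u i ≠ z := by
          by_contra hns
          push Not at hns
          have := Fintype.card_le_of_surjective u hns
          simp at this
        have h1 := upd u hu j z hz
        have hz2 : ∀ l, Function.update u j z l ≠ V i := by
          intro l
          by_cases hl : l = j
          · subst hl; simp; rw [← hj]; exact (hz l).symm
          · rw [Function.update_of_ne hl, ← hj]; exact fun hh => hl (hu hh)
        have h2 := upd _ h1.1 i (V i) hz2
        refine ⟨_, _, h1.1, h2.1, h1.2, h2.2, cnt _ (by simp) ?_⟩
        intro l hl
        by_cases hli : l = i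
        · subst hli; exact absurd hl hi
        · have hlj : l ≠ j := by
            rintro rfl; exact hli (hV (hl.symm.trans hj))
          rw [Function.update_of_ne hli, Function.update_of_ne hlj, hl]
      · push Not at hmiss
        have h1 := upd u hu i (V i) hmiss
        refine ⟨u, _, hu, h1.1, fun i i' h hh => h (hu hh), h1.2, cnt _ (by simp) ?_⟩
        intro l hl
        by_cases hli : l = i
        · subst hli; exact absurd hl hi
        · rw [Function.update_of_ne hli, hl]
    obtain ⟨U, U0, UV, Ui, Uc⟩ := ih u2 hu2 hc2
    refine ⟨fun t => match t with | 0 => u | 1 => u1 | t + 2 => U t, rfl, ?_, ?_, ?_⟩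
    · intro t ht
      obtain ⟨s, rfl⟩ : ∃ s, t = s + 2 := ⟨t - 2, by omega⟩
      exact UV s (by omega)
    · rintro (_ | _ | t)
      · exact hu
      · exact hu1
      · exact Ui t
    · rintro (_ | _ | t)
      · exact c1
      · simp only [U0]; exact c2
      · exact Uc t

theorem ext_window (d n : ℕ) (hn : 2 * (d + 1) * (d + 1) + d ≤ n)
    (u v : Fin (d + 1) → Fin (d + 2)) (hu : Function.Injective u) (hv : Function.Injective v) :
    ∃ f : ℕ → Fin (d + 2), (∀ j : Fin (d + 1), f j = u j) ∧ (∀ j : Fin (d + 1), f (n - j) = v j) ∧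
      ∀ i j, i < j → j ≤ i + d → f i ≠ f j := by
  let V : Fin (d + 1) → Fin (d + 2) := fun r => v ⟨(n - r) % (d + 1), Nat.mod_lt _ (by omega)⟩
  have hV : Function.Injective V := by
    intro r r' hr
    have h1 := hv hr
    rw [Fin.mk.injEq] at h1
    have a1 := r.2
    have a2 := r'.2
    have hd : d ≤ n := by omega
    have h2 : (n - r : ℕ) ≡ (n - r' : ℕ) [MOD (d + 1)] := h1
    have h3 : (r : ℕ) ≡ r' [MOD (d + 1)] := by
      have e : (n - r) + (r + r') = n + r' := by omega
      have e' : (n - r') + (r + r') = n + r := by omega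
      have := h2.add_right (r + r' : ℕ)
      rw [e, e'] at this
      exact (Nat.ModEq.add_left_cancel' n this).symm
    have h4 : (r : ℕ) % (d + 1) = r' % (d + 1) := h3
    rw [Nat.mod_eq_of_lt a1, Nat.mod_eq_of_lt a2] at h4
    exact Fin.ext h4
  obtain ⟨U, U0, UV, Ui, Uc⟩ := ext_chain V hV (d + 1) u hu
    ((Finset.card_le_univ _).trans (by simp))
  refine ⟨fun i => U (i / (d + 1)) ⟨i % (d + 1), Nat.mod_lt _ (by omega)⟩, ?_, ?_, ?_⟩
  · intro j
    have e1 : (j : ℕ) / (d + 1) = 0 := Nat.div_eq_of_lt j.2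
    simp only [e1, U0]
    congr 1
    exact Fin.ext (Nat.mod_eq_of_lt j.2)
  · intro j
    have hj := j.2
    have h1 : 2 * (d + 1) ≤ (n - j) / (d + 1) := by
      rw [Nat.le_div_iff_mul_le (by omega)]
      omega
    simp only [UV _ h1]
    show v _ = v j
    congr 1
    apply Fin.ext
    show (n - (n - j) % (d + 1)) % (d + 1) = j
    have h2 := Nat.div_add_mod (n - j) (d + 1)
    have h3 : n - (n - j) % (d + 1) = j + (d + 1) * ((n - j) / (d + 1)) := by omega
    rw [h3, Nat.add_mul_mod_self_left, Nat.mod_eq_of_lt hj]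
  · intro i j hij hjd
    have hi := Nat.div_add_mod i (d + 1)
    have hj := Nat.div_add_mod j (d + 1)
    have li := Nat.mod_lt i (show d + 1 > 0 by omega)
    have lj := Nat.mod_lt j (show d + 1 > 0 by omega)
    have b1 : i / (d + 1) ≤ j / (d + 1) := Nat.div_le_div_right hij.le
    have b2 : j / (d + 1) ≤ i / (d + 1) + 1 := by
      have : j / (d + 1) ≤ (i + (d + 1)) / (d + 1) := Nat.div_le_div_right (by omega)
      rwa [Nat.add_div_right _ (by omega)] at this
    have hc : j / (d + 1) = i / (d + 1) ∨ j / (d + 1) = i / (d + 1) + 1 := by omega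
    rcases hc with hc | hc
    · simp only [hc]
      intro hh
      have := Ui _ hh
      rw [Fin.mk.injEq] at this
      rw [hc] at hj
      omega
    · simp only [hc]
      apply Uc
      intro hh
      rw [Fin.mk.injEq] at hh
      rw [hc, Nat.mul_add] at hj
      omega

/-! ### The Borel coloring with one extra color -/

/-- Greedy maximal sparse set along the orbits of `T`, following the labels `ID`. -/
def greedyMark {X : Type*} (T : Equiv.Perm X) (ID : X → ℕ) (K : ℕ) (x : X) : Prop :=
  ∀ j : ℤ, |j| ≤ K → ∀ _h : ID ((T ^ j) x) < ID x, ¬ greedyMark T ID K ((T ^ j) x)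
termination_by ID x

theorem zpow_zpow_apply {X : Type*} (T : Equiv.Perm X) (i j : ℤ) (x : X) :
    (T ^ i) ((T ^ j) x) = (T ^ (i + j)) x := by
  rw [zpow_add]; rfl

theorem flip_zpow {X : Type*} (T a : Equiv.Perm X) (haT : ∀ x, a (T x) = T⁻¹ (a x)) (j : ℤ) (x : X) :
    a ((T ^ j) x) = (T ^ (-j)) (a x) := by
  have h : SemiconjBy a T T⁻¹ := by
    ext y; exact haT y
  have := h.zpow_right j
  have h2 := congrArg (fun f : Equiv.Perm X => f x) this.eq
  simpa using h2

theorem measurable_zpow {X : Type*} [MeasurableSpace X] (T : Equiv.Perm X) (hT : Measurable T)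
    (hT' : Measurable (T⁻¹ : Equiv.Perm X)) (j : ℤ) : Measurable (T ^ j : Equiv.Perm X) := by
  have hp : ∀ (S : Equiv.Perm X), Measurable S → ∀ n : ℕ, Measurable (S ^ n : Equiv.Perm X) := by
    intro S hS n
    induction n with
    | zero => simpa using measurable_id
    | succ n ih => rw [pow_succ]; exact ih.comp hS
  obtain ⟨n, rfl | rfl⟩ := j.eq_nat_or_neg
  · simpa using hp T hT n
  · have := hp T⁻¹ hT' n
    simpa using this

theorem greedyMark_measurable {X : Type*} [MeasurableSpace X] (T : Equiv.Perm X)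
    (hT : ∀ j : ℤ, Measurable (T ^ j : Equiv.Perm X)) (ID : X → ℕ) (hID : Measurable ID) (K : ℕ) :
    MeasurableSet {x | greedyMark T ID K x} := by
  have key : ∀ r : ℕ, MeasurableSet {x | ID x = r ∧ greedyMark T ID K x} := by
    intro r
    induction r using Nat.strong_induction_on with
    | _ r ih =>
      have e : {x | ID x = r ∧ greedyMark T ID K x} =
          {x | ID x = r} ∩ ⋂ j : ℤ, ⋂ _ : |j| ≤ K, ⋂ r' : ℕ, ⋂ _ : r' < r,
            ((T ^ j : Equiv.Perm X) ⁻¹' {x | ID x = r' ∧ greedyMark T ID K x})ᶜ := by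
        ext x
        simp only [Set.mem_ofPred_eq, Set.mem_inter_iff, Set.mem_iInter, Set.mem_compl_iff,
          Set.mem_preimage, not_and]
        constructor
        · rintro ⟨rfl, h2⟩
          refine ⟨rfl, fun j hj r' hr' hid => ?_⟩
          rw [greedyMark] at h2
          exact h2 j hj (hid ▸ hr')
        · rintro ⟨rfl, h2⟩
          refine ⟨rfl, ?_⟩
          rw [greedyMark]
          exact fun j hj hlt => h2 j hj _ hlt rfl
      rw [e]
      refine (hID (measurableSet_singleton r)).inter ?_
      refine MeasurableSet.iInter fun j => MeasurableSet.iInter fun _ =>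
        MeasurableSet.iInter fun r' => MeasurableSet.iInter fun hr' => ?_
      exact (hT j (ih r' hr')).compl
  have e : {x | greedyMark T ID K x} = ⋃ r : ℕ, {x | ID x = r ∧ greedyMark T ID K x} := by
    ext x; simp
  rw [e]
  exact MeasurableSet.iUnion key

theorem greedyMark_flip {X : Type*} (T a : Equiv.Perm X) (haa : ∀ x, a (a x) = x)
    (haT : ∀ x, a (T x) = T⁻¹ (a x)) (ID : X → ℕ)
    (hIDa : ∀ x, ID (a x) = ID x) (K : ℕ) (x : X) :
    greedyMark T ID K (a x) ↔ greedyMark T ID K x := by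
  have key : ∀ (r : ℕ) (x : X), ID x = r → greedyMark T ID K x → greedyMark T ID K (a x) := by
    intro r
    induction r using Nat.strong_induction_on with
    | _ r ih =>
      intro x hx h
      rw [greedyMark] at h ⊢
      intro j hj hlt hm
      have e : (T ^ j) (a x) = a ((T ^ (-j)) x) := by
        rw [flip_zpow T a haT, neg_neg]
      rw [e] at hlt hm
      rw [hIDa, hIDa] at hlt
      have := ih _ (hx ▸ hlt) (a ((T ^ (-j)) x)) (hIDa _) hm
      rw [haa] at this
      exact h (-j) (by rwa [abs_neg]) hlt this
  exact ⟨fun h => by simpa [haa] using key _ (a x) rfl h, key _ x rfl⟩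

theorem greedyMark_sparse {X : Type*} (T : Equiv.Perm X) (ID : X → ℕ) (K : ℕ)
    (hp : ∀ x, ∀ j : ℤ, j ≠ 0 → |j| ≤ K → ID ((T ^ j) x) ≠ ID x)
    (x : X) (j : ℤ) (hj0 : j ≠ 0) (hj : |j| ≤ K) (h1 : greedyMark T ID K x) :
    ¬ greedyMark T ID K ((T ^ j) x) := by
  intro h2
  rcases lt_or_gt_of_ne (hp x j hj0 hj) with h | h
  · rw [greedyMark] at h1
    exact h1 j hj h h2
  · rw [greedyMark] at h2
    refine h2 (-j) (by rwa [abs_neg]) ?_ ?_ <;> rw [zpow_zpow_apply] <;> simpa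

theorem greedyMark_exists {X : Type*} (T : Equiv.Perm X) (ID : X → ℕ) (K : ℕ) (x : X) :
    ∃ j : ℤ, |j| ≤ K ∧ greedyMark T ID K ((T ^ j) x) := by
  by_cases h : greedyMark T ID K x
  · exact ⟨0, by simp, by simpa using h⟩
  · rw [greedyMark] at h
    push Not at h
    obtain ⟨j, h1, _, h3⟩ := h
    exact ⟨j, h1, h3⟩

/-- The periodic pattern around a marker. -/
def pat (d : ℕ) (s : ℤ) : Fin (d + 2) :=
  ⟨(s % (d + 1 : ℤ)).toNat, by
    have h1 := Int.emod_lt_of_pos s (show (0 : ℤ) < d + 1 by omega)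
    have h2 := Int.emod_nonneg s (show (d + 1 : ℤ) ≠ 0 by omega)
    omega⟩

theorem pat_ne (d : ℕ) (e s t : ℤ) (he : e = 1 ∨ e = -1) (h1 : s < t) (h2 : t ≤ s + d) :
    pat d (e * s) ≠ pat d (e * t) := by
  intro h
  unfold pat at h
  rw [Fin.mk.injEq] at h
  have n1 := Int.emod_nonneg (e * s) (show (d + 1 : ℤ) ≠ 0 by omega)
  have n2 := Int.emod_nonneg (e * t) (show (d + 1 : ℤ) ≠ 0 by omega)
  have h3 : (e * s) % (d + 1 : ℤ) = (e * t) % (d + 1 : ℤ) := by omega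
  have h4 : (d + 1 : ℤ) ∣ e * t - e * s := Int.ModEq.dvd h3
  have h5 : (d + 1 : ℤ) ∣ t - s := by
    rcases he with rfl | rfl
    · simpa using h4
    · have e : -(t - s) = -1 * t - -1 * s := by ring
      rw [← dvd_neg, e]; exact h4
  have := Int.le_of_dvd (by omega) h5
  omega

theorem exists_fill (d : ℕ) : ∃ f : ℕ → ℤ → ℤ → ℕ → Fin (d + 2),
    ∀ n e e', 2 * (d + 1) * (d + 1) + d ≤ n → (e = 1 ∨ e = -1) → (e' = 1 ∨ e' = -1) →
      (∀ j : ℕ, j ≤ d → f n e e' j = pat d (e * j)) ∧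
      (∀ j : ℕ, j ≤ d → f n e e' (n - j) = pat d (e' * j)) ∧
      ∀ i j, i < j → j ≤ i + d → f n e e' i ≠ f n e e' j := by
  have inj : ∀ e : ℤ, (e = 1 ∨ e = -1) →
      Function.Injective (fun j : Fin (d + 1) => pat d (e * (j : ℕ))) := by
    intro e he i j hij
    by_contra hne
    have hi := i.2
    have hj := j.2
    have hne' : (i : ℕ) ≠ j := fun h => hne (Fin.ext h)
    rcases lt_or_gt_of_ne hne' with h | h
    · exact pat_ne d e i j he (by omega) (by omega) hij
    · exact pat_ne d e j i he (by omega) (by omega) hij.symm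
  have main : ∀ n e e', ∃ g : ℕ → Fin (d + 2), 2 * (d + 1) * (d + 1) + d ≤ n →
      (e = 1 ∨ e = -1) → (e' = 1 ∨ e' = -1) →
      (∀ j : ℕ, j ≤ d → g j = pat d (e * j)) ∧
      (∀ j : ℕ, j ≤ d → g (n - j) = pat d (e' * j)) ∧
      ∀ i j, i < j → j ≤ i + d → g i ≠ g j := by
    intro n e e'
    by_cases h : 2 * (d + 1) * (d + 1) + d ≤ n ∧ (e = 1 ∨ e = -1) ∧ (e' = 1 ∨ e' = -1)
    · obtain ⟨g, h1, h2, h3⟩ := ext_window d n h.1 _ _ (inj e h.2.1) (inj e' h.2.2)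
      exact ⟨g, fun _ _ _ => ⟨fun j hj => h1 ⟨j, by omega⟩, fun j hj => h2 ⟨j, by omega⟩, h3⟩⟩
    · exact ⟨fun _ => 0, fun a b c => absurd ⟨a, b, c⟩ h⟩
  choose f hf using main
  exact ⟨f, hf⟩

/-- The relation "`c` is the color of `x`". -/
def ColRel {X : Type*} {d : ℕ} (T : Equiv.Perm X) (M : X → Prop) (ID : X → ℕ) (O : X → ℤ)
    (f : ℕ → ℤ → ℤ → ℕ → Fin (d + 2)) (x : X) (c : Fin (d + 2)) : Prop :=
  ∃ u v : ℤ, (u ≤ 0 ∧ 0 ≤ v ∨ v ≤ 0 ∧ 0 ≤ u) ∧ u ≠ v ∧ M ((T ^ u) x) ∧ M ((T ^ v) x) ∧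
    (∀ i : ℤ, (u < i ∧ i < v ∨ v < i ∧ i < u) → ¬ M ((T ^ i) x)) ∧
    ID ((T ^ u) x) < ID ((T ^ v) x) ∧
    f (v - u).natAbs ((v - u).sign * O ((T ^ u) x)) ((u - v).sign * O ((T ^ v) x)) u.natAbs = c

theorem ColRel_flip {X : Type*} {d : ℕ} (T a : Equiv.Perm X) (haT : ∀ x, a (T x) = T⁻¹ (a x))
    (M : X → Prop) (hM : ∀ x, M (a x) ↔ M x) (ID : X → ℕ) (hID : ∀ x, ID (a x) = ID x)
    (O : X → ℤ) (hO : ∀ x, O (a x) = - O x)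
    (f : ℕ → ℤ → ℤ → ℕ → Fin (d + 2)) (x : X) (c : Fin (d + 2))
    (h : ColRel T M ID O f x c) : ColRel T M ID O f (a x) c := by
  obtain ⟨u, v, h1, h2, h3, h4, h5, h6, h7⟩ := h
  have e : ∀ j : ℤ, (T ^ j) (a x) = a ((T ^ (-j)) x) := fun j => by
    rw [flip_zpow T a haT, neg_neg]
  refine ⟨-u, -v, by omega, by omega, ?_, ?_, ?_, ?_, ?_⟩
  · rw [e, hM, neg_neg]; exact h3
  · rw [e, hM, neg_neg]; exact h4
  · intro i hi
    rw [e, hM]; exact h5 (-i) (by omega)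
  · simp only [e, hID, neg_neg]; exact h6
  · rw [← h7]
    simp only [e, hO, neg_neg]
    have e1 : -v - -u = -(v - u) := by ring
    have e2 : -u - -v = -(u - v) := by ring
    rw [e1, e2, Int.sign_neg, Int.sign_neg, Int.natAbs_neg, Int.natAbs_neg, neg_mul_neg, neg_mul_neg]

theorem ColRel_measurable {X : Type*} [MeasurableSpace X] {d : ℕ} (T : Equiv.Perm X)
    (hT : ∀ j : ℤ, Measurable (T ^ j : Equiv.Perm X))
    (M : X → Prop) (hM : MeasurableSet {x | M x}) (ID : X → ℕ) (hID : Measurable ID)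
    (O : X → ℤ) (hO : Measurable O)
    (f : ℕ → ℤ → ℤ → ℕ → Fin (d + 2)) (c : Fin (d + 2)) :
    MeasurableSet {x | ColRel T M ID O f x c} := by
  have hM' : Measurable M := measurableSet_setOfPred.1 hM
  have hMj : ∀ j : ℤ, Measurable (fun x => M ((T ^ j) x)) := fun j => hM'.comp (hT j)
  apply measurableSet_setOfPred.2
  unfold ColRel
  refine Measurable.exists fun u => Measurable.exists fun v => ?_
  refine Measurable.and measurable_const (Measurable.and measurable_const ?_)
  refine (hMj u).and ((hMj v).and (Measurable.and ?_ (Measurable.and ?_ ?_)))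
  · exact Measurable.forall fun i => Measurable.imp measurable_const (hMj i).not
  · exact measurableSet_setOfPred.1 (measurableSet_lt (hID.comp (hT u)) (hID.comp (hT v)))
  · have h1 : Measurable (fun x => (O ((T ^ u) x), O ((T ^ v) x))) :=
      (hO.comp (hT u)).prodMk (hO.comp (hT v))
    have h2 : Measurable (fun y : ℤ × ℤ =>
      f (v - u).natAbs ((v - u).sign * y.1) ((u - v).sign * y.2) u.natAbs = c) :=
      measurable_of_countable _
    exact h2.comp h1

theorem exists_gap {X : Type*} (T : Equiv.Perm X) (M : X → Prop) (K : ℕ)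
    (hex : ∀ x, ∃ j : ℤ, |j| ≤ K ∧ M ((T ^ j) x)) (x : X) :
    ∃ L R : ℤ, L ≤ 0 ∧ 0 < R ∧ M ((T ^ L) x) ∧ M ((T ^ R) x) ∧
      (∀ i, L < i → i < R → ¬ M ((T ^ i) x)) ∧ R - L ≤ 4 * K + 1 := by
  obtain ⟨j1, a1, b1⟩ := hex ((T ^ (K + 1 : ℤ)) x)
  obtain ⟨j2, a2, b2⟩ := hex ((T ^ (-K : ℤ)) x)
  rw [zpow_zpow_apply] at b1 b2
  rw [abs_le] at a1 a2
  obtain ⟨R, ⟨r1, r2⟩, r3⟩ := Int.exists_least_of_bdd (P := fun i => 0 < i ∧ M ((T ^ i) x))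
    ⟨0, fun z hz => hz.1.le⟩ ⟨_, by omega, b1⟩
  obtain ⟨L, ⟨l1, l2⟩, l3⟩ := Int.exists_greatest_of_bdd (P := fun i => i ≤ 0 ∧ M ((T ^ i) x))
    ⟨0, fun z hz => hz.1⟩ ⟨_, by omega, b2⟩
  have := r3 _ ⟨by omega, b1⟩
  have := l3 _ ⟨by omega, b2⟩
  refine ⟨L, R, l1, r1, l2, r2, ?_, by omega⟩
  intro i h1 h2 hi
  by_cases h0 : i ≤ 0
  · have := l3 i ⟨h0, hi⟩; omega
  · have := r3 i ⟨by omega, hi⟩; omega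

theorem upper_abstract {X : Type*} [MeasurableSpace X] (d : ℕ) (T a : Equiv.Perm X)
    (hT : Measurable T) (hT' : Measurable (T⁻¹ : Equiv.Perm X)) (ha : Measurable a)
    (haa : ∀ x, a (a x) = x) (haT : ∀ x, a (T x) = T⁻¹ (a x))
    (hID : ∀ B : ℕ, ∃ ID0 : X → ℕ, Measurable ID0 ∧
      (∀ x, ∀ j : ℤ, j ≠ 0 → |j| ≤ B → ID0 ((T ^ j) x) ≠ ID0 x) ∧
      (∀ x, ∀ j : ℤ, |j| ≤ B → ID0 (a ((T ^ j) x)) ≠ ID0 x)) :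
    ∃ col : X → Fin (d + 2), Measurable col ∧ (∀ x, col (a x) = col x) ∧
      ∀ x, ∀ j : ℤ, 1 ≤ j → j ≤ d → col ((T ^ j) x) ≠ col x := by
  obtain ⟨f, hf⟩ := exists_fill d
  obtain ⟨K, hK⟩ : ∃ K, K = 2 * (d + 1) * (d + 1) + d := ⟨_, rfl⟩
  rw [← hK] at hf
  have hKd : d ≤ K := by rw [hK]; omega
  obtain ⟨ID0, hm, hp1, hp2⟩ := hID (4 * K + 1)
  have hTj := measurable_zpow T hT hT'
  let ID : X → ℕ := fun x => min (ID0 x) (ID0 (a x))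
  let O : X → ℤ := fun x => if ID0 x < ID0 (a x) then 1 else -1
  have hIDm : Measurable ID := hm.min (hm.comp ha)
  have hOm : Measurable O :=
    Measurable.ite (measurableSet_lt hm (hm.comp ha)) measurable_const measurable_const
  have hIDa : ∀ x, ID (a x) = ID x := by
    intro x; simp only [ID, haa]; exact min_comm _ _
  have hO1 : ∀ x, O x = 1 ∨ O x = -1 := by
    intro x; simp only [O]; split_ifs <;> simp
  have hOa : ∀ x, O (a x) = - O x := by
    intro x
    have := hp2 x 0 (by simp; omega)
    simp only [zpow_zero, Equiv.Perm.coe_one, id] at this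
    simp only [O, haa]
    split_ifs <;> omega
  have hIDp : ∀ x, ∀ j : ℤ, j ≠ 0 → |j| ≤ (4 * K + 1 : ℕ) → ID ((T ^ j) x) ≠ ID x := by
    intro x j h0 hj
    have e1 := hp1 x j h0 hj
    have e2 := hp2 x j hj
    have e3 := hp1 (a x) (-j) (by omega) (by rwa [abs_neg])
    have e4 := hp2 (a x) (-j) (by rwa [abs_neg])
    rw [← flip_zpow T a haT] at e3 e4
    rw [haa] at e4
    simp only [ID]
    omega
  obtain ⟨M, hMdef⟩ : ∃ M, M = greedyMark T ID K := ⟨_, rfl⟩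
  have hMm : MeasurableSet {x | M x} := hMdef ▸ greedyMark_measurable T hTj ID hIDm K
  have hMa : ∀ x, M (a x) ↔ M x := hMdef ▸ greedyMark_flip T a haa haT ID hIDa K
  have hMs : ∀ x, ∀ j : ℤ, j ≠ 0 → |j| ≤ K → M x → ¬ M ((T ^ j) x) := hMdef ▸
    greedyMark_sparse T ID K (fun x j h0 hj => hIDp x j h0 (hj.trans (by push_cast; omega)))
  have hMe : ∀ x, ∃ j : ℤ, |j| ≤ K ∧ M ((T ^ j) x) := hMdef ▸ greedyMark_exists T ID K
  -- distance between markers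
  have hMs' : ∀ x, ∀ u v : ℤ, u < v → M ((T ^ u) x) → M ((T ^ v) x) → K < v - u := by
    intro x u v huv h1 h2
    by_contra hle
    have := hMs _ (v - u) (by omega) (by rw [abs_of_pos] <;> omega) h1
    rw [zpow_zpow_apply, sub_add_cancel] at this
    exact this h2
  have sgn : ∀ z : ℤ, z ≠ 0 → ∀ x, z.sign * O x = 1 ∨ z.sign * O x = -1 := by
    intro z hz x
    rcases lt_or_gt_of_ne hz with h | h
    · rw [Int.sign_eq_neg_one_of_neg h]; rcases hO1 x with h | h <;> simp [h]
    · rw [Int.sign_eq_one_of_pos h]; rcases hO1 x with h | h <;> simp [h]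
  -- colors at markers
  have hmark : ∀ x c, M x → ColRel T M ID O f x c → c = pat d 0 := by
    rintro x c hx ⟨u, v, h1, h2, h3, h4, h5, h6, rfl⟩
    have hn : K ≤ (v - u).natAbs := by
      rcases lt_or_gt_of_ne h2 with h | h
      · have := hMs' x u v h h3 h4; omega
      · have := hMs' x v u h h4 h3; omega
    obtain ⟨g1, g2, -⟩ := hf _ _ _ hn (sgn (v - u) (by omega) ((T ^ u) x))
      (sgn (u - v) (by omega) ((T ^ v) x))
    have h0 : u = 0 ∨ v = 0 := by
      by_contra hne
      exact h5 0 (by omega) (by simpa using hx)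
    rcases h0 with rfl | rfl
    · have := g1 0 (by omega)
      simpa using this
    · have := g2 0 (by omega)
      simpa using this
  have huniq : ∀ x c c', ColRel T M ID O f x c → ColRel T M ID O f x c' → c = c' := by
    intro x c c' hc hc'
    by_cases hx : M x
    · rw [hmark x c hx hc, hmark x c' hx hc']
    · obtain ⟨u, v, h1, h2, h3, h4, h5, h6, rfl⟩ := hc
      obtain ⟨u', v', h1', h2', h3', h4', h5', h6', rfl⟩ := hc'
      have z : ∀ w : ℤ, M ((T ^ w) x) → w ≠ 0 := by
        rintro w hw rfl; exact hx (by simpa using hw)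
      have z1 := z u h3
      have z2 := z v h4
      have z3 := z u' h3'
      have z4 := z v' h4'
      have i1 : ¬ (u < u' ∧ u' < v ∨ v < u' ∧ u' < u) := fun hh => h5 u' hh h3'
      have i2 : ¬ (u < v' ∧ v' < v ∨ v < v' ∧ v' < u) := fun hh => h5 v' hh h4'
      have i3 : ¬ (u' < u ∧ u < v' ∨ v' < u ∧ u < u') := fun hh => h5' u hh h3
      have i4 : ¬ (u' < v ∧ v < v' ∨ v' < v ∧ v < u') := fun hh => h5' v hh h4
      have : (u = u' ∧ v = v') ∨ (u = v' ∧ v = u') := by omega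
      rcases this with ⟨rfl, rfl⟩ | ⟨rfl, rfl⟩
      · rfl
      · omega
  -- filling a gap
  have hfill : ∀ x, ∀ L R : ℤ, L < R → M ((T ^ L) x) → M ((T ^ R) x) →
      (∀ i, L < i → i < R → ¬ M ((T ^ i) x)) → R - L ≤ 4 * K + 1 →
      ∃ g : ℤ → Fin (d + 2), (∀ i, L ≤ i → i ≤ R → ColRel T M ID O f ((T ^ i) x) (g i)) ∧
        (∀ i j, L ≤ i → i < j → j ≤ R → j ≤ i + d → g i ≠ g j) ∧
        (∀ i, L ≤ i → i ≤ L + d → i ≤ R → g i = pat d (O ((T ^ L) x) * (i - L))) ∧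
        (∀ i, L ≤ i → i ≤ R → R ≤ i + d → g i = pat d (O ((T ^ R) x) * (i - R))) := by
    intro x L R hLR hL hR hbet hlen
    have hn := hMs' x L R hLR hL hR
    have hne : ID ((T ^ R) x) ≠ ID ((T ^ L) x) := by
      have := hIDp ((T ^ L) x) (R - L) (by omega) (by rw [abs_of_pos] <;> push_cast <;> omega)
      rwa [zpow_zpow_apply, sub_add_cancel] at this
    have hs1 : (R - L).sign = 1 := Int.sign_eq_one_of_pos (by omega)
    have hs2 : (L - R).sign = -1 := Int.sign_eq_neg_one_of_neg (by omega)
    rcases lt_or_gt_of_ne hne with hlt | hlt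
    · -- the origin is `R`
      obtain ⟨g1, g2, g3⟩ := hf (L - R).natAbs _ _ (by omega) (sgn (L - R) (by omega) ((T ^ R) x))
        (sgn (R - L) (by omega) ((T ^ L) x))
      refine ⟨fun i => f (L - R).natAbs ((L - R).sign * O ((T ^ R) x))
        ((R - L).sign * O ((T ^ L) x)) (R - i).natAbs, ?_, ?_, ?_, ?_⟩
      · intro i hi1 hi2
        refine ⟨R - i, L - i, by omega, by omega, ?_, ?_, ?_, ?_, ?_⟩
        · rwa [zpow_zpow_apply, sub_add_cancel]
        · rwa [zpow_zpow_apply, sub_add_cancel]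
        · intro l hl
          rw [zpow_zpow_apply]; exact hbet _ (by omega) (by omega)
        · rwa [zpow_zpow_apply, sub_add_cancel, zpow_zpow_apply, sub_add_cancel]
        · rw [zpow_zpow_apply, sub_add_cancel, zpow_zpow_apply, sub_add_cancel,
            sub_sub_sub_cancel_right, sub_sub_sub_cancel_right]
      · intro i j a1 a2 a3 a4
        exact (g3 (R - j).natAbs (R - i).natAbs (by omega) (by omega)).symm
      · intro i a1 a2 a3
        have := g2 (i - L).natAbs (by omega)
        have e : (L - R).natAbs - (i - L).natAbs = (R - i).natAbs := by omega
        rw [e] at this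
        show f _ _ _ _ = _
        rw [this, hs1, one_mul]
        congr 2
        omega
      · intro i a1 a2 a3
        show f _ _ _ _ = _
        rw [g1 (R - i).natAbs (by omega), hs2]
        congr 1
        have : ((R - i).natAbs : ℤ) = R - i := by omega
        rw [this]; ring
    · obtain ⟨g1, g2, g3⟩ := hf (R - L).natAbs _ _ (by omega) (sgn (R - L) (by omega) ((T ^ L) x))
        (sgn (L - R) (by omega) ((T ^ R) x))
      refine ⟨fun i => f (R - L).natAbs ((R - L).sign * O ((T ^ L) x))
        ((L - R).sign * O ((T ^ R) x)) (L - i).natAbs, ?_, ?_, ?_, ?_⟩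
      · intro i hi1 hi2
        refine ⟨L - i, R - i, by omega, by omega, ?_, ?_, ?_, ?_, ?_⟩
        · rwa [zpow_zpow_apply, sub_add_cancel]
        · rwa [zpow_zpow_apply, sub_add_cancel]
        · intro l hl
          rw [zpow_zpow_apply]; exact hbet _ (by omega) (by omega)
        · rwa [zpow_zpow_apply, sub_add_cancel, zpow_zpow_apply, sub_add_cancel]
        · rw [zpow_zpow_apply, sub_add_cancel, zpow_zpow_apply, sub_add_cancel,
            sub_sub_sub_cancel_right, sub_sub_sub_cancel_right]
      · intro i j a1 a2 a3 a4
        exact g3 (L - i).natAbs (L - j).natAbs (by omega) (by omega)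
      · intro i a1 a2 a3
        show f _ _ _ _ = _
        rw [g1 (L - i).natAbs (by omega), hs1, one_mul]
        congr 2
        omega
      · intro i a1 a2 a3
        have := g2 (R - i).natAbs (by omega)
        have e : (R - L).natAbs - (R - i).natAbs = (L - i).natAbs := by omega
        rw [e] at this
        show f _ _ _ _ = _
        rw [this, hs2]
        congr 1
        have : ((R - i).natAbs : ℤ) = R - i := by omega
        rw [this]; ring
  have hexist : ∀ x, ∃ c, ColRel T M ID O f x c := by
    intro x
    obtain ⟨L, R, h1, h2, h3, h4, h5, h6⟩ := exists_gap T M K hMe x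
    obtain ⟨g, hg, -⟩ := hfill x L R (by omega) h3 h4 h5 h6
    exact ⟨g 0, by simpa using hg 0 h1 h2.le⟩
  choose col hcol using hexist
  refine ⟨col, ?_, ?_, ?_⟩
  · apply measurable_to_countable'
    intro c
    have e : col ⁻¹' {c} = {x | ColRel T M ID O f x c} := by
      ext x
      constructor
      · rintro rfl; exact hcol x
      · exact fun h => huniq x _ _ (hcol x) h
    rw [e]
    exact ColRel_measurable T hTj M hMm ID hIDm O hOm f c
  · intro x
    exact huniq _ _ _ (hcol (a x)) (ColRel_flip T a haT M hMa ID hIDa O hOa f x _ (hcol x))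
  · intro x j hj1 hjd
    obtain ⟨L, R, h1, h2, h3, h4, h5, h6⟩ := exists_gap T M K hMe x
    obtain ⟨g, hg, hg1, -, hg2⟩ := hfill x L R (by omega) h3 h4 h5 h6
    have c0 : col x = g 0 := huniq _ _ _ (hcol x) (by simpa using hg 0 h1 h2.le)
    by_cases hjR : j ≤ R
    · have cj : col ((T ^ j) x) = g j := huniq _ _ _ (hcol _) (hg j (by omega) hjR)
      rw [c0, cj]
      exact (hg1 0 j h1 (by omega) hjR (by omega)).symm
    · obtain ⟨L', R', h1', h2', h3', h4', h5', h6'⟩ := exists_gap T M K hMe ((T ^ R) x)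
      have hL' : L' = 0 := by
        by_contra hne
        exact h5' 0 (by omega) h2' (by simpa using h4)
      subst hL'
      obtain ⟨g', hg', -, hg1', -⟩ := hfill _ 0 R' h2' h3' h4' h5' h6'
      have := hMs' _ 0 R' h2' h3' h4'
      have cj : col ((T ^ j) x) = g' (j - R) := by
        have := hg' (j - R) (by omega) (by omega)
        rw [zpow_zpow_apply, sub_add_cancel] at this
        exact huniq _ _ _ (hcol _) this
      rw [c0, cj, hg1' _ (by omega) (by omega) (by omega), hg2 0 h1 (by omega) (by omega)]
      simp only [zpow_zero, Equiv.Perm.coe_one, id]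
      exact (pat_ne d _ (0 - R) (j - R - 0) (hO1 _) (by omega) (by omega)).symm

/-! ### Baire category on the shift space -/

section Shift

variable {G : Type*} [Group G]

theorem shiftMap_mul (g h : G) (x : G → Bool) : shiftMap (g * h) x = shiftMap g (shiftMap h x) := by
  funext l; simp [shiftMap, mul_assoc]

theorem shiftMap_one (x : G → Bool) : shiftMap (1 : G) x = x := by
  funext l; simp [shiftMap]

theorem shiftMap_continuous (g : G) : Continuous (shiftMap g) :=
  continuous_pi fun h => continuous_apply (g⁻¹ * h)

theorem shiftMap_measurable (g : G) : Measurable (shiftMap g) :=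
  measurable_pi_lambda _ fun h => measurable_pi_apply (g⁻¹ * h)

/-- The shift by `g` as a homeomorphism. -/
def shiftHomeo (g : G) : (G → Bool) ≃ₜ (G → Bool) where
  toFun := shiftMap g
  invFun := shiftMap g⁻¹
  left_inv x := by rw [← shiftMap_mul, inv_mul_cancel, shiftMap_one]
  right_inv x := by rw [← shiftMap_mul, mul_inv_cancel, shiftMap_one]
  continuous_toFun := shiftMap_continuous g
  continuous_invFun := shiftMap_continuous g⁻¹

theorem shiftMap_mem_freePart (g : G) {x : G → Bool} (hx : x ∈ FreePart G) :
    shiftMap g x ∈ FreePart G := by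
  intro h hh he
  refine hx (g⁻¹ * h * g) ?_ ?_
  · intro h1
    apply hh
    calc h = g * (g⁻¹ * h * g) * g⁻¹ := by group
      _ = 1 := by rw [h1]; group
  · rw [shiftMap_mul, shiftMap_mul, he, ← shiftMap_mul, inv_mul_cancel, shiftMap_one]

instance freePartAction : MulAction G (FreePart G) where
  smul g x := ⟨shiftMap g x.1, shiftMap_mem_freePart g x.2⟩
  one_smul x := Subtype.ext (shiftMap_one x.1)
  mul_smul g h x := Subtype.ext (shiftMap_mul g h x.1)

theorem freePart_smul_val (g : G) (x : FreePart G) :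
    ((g • x : FreePart G) : G → Bool) = shiftMap g x.1 := rfl

theorem freePart_smul_measurable (g : G) : Measurable (fun x : FreePart G => g • x) :=
  Measurable.subtype_mk ((shiftMap_measurable g).comp measurable_subtype_coe)

theorem freePart_smul_ne (g : G) (hg : g ≠ 1) (x : FreePart G) : g • x ≠ x :=
  fun h => x.2 g hg (congrArg Subtype.val h)

theorem isOpen_cyl {U : Set (G → Bool)} (hU : IsOpen U) {x : G → Bool} (hx : x ∈ U) :
    ∃ F : Finset G, ∀ y : G → Bool, (∀ h ∈ F, y h = x h) → y ∈ U := by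
  obtain ⟨F, u, h1, h2⟩ := isOpen_pi_iff.1 hU x hx
  refine ⟨F, fun y hy => h2 fun h hh => ?_⟩
  rw [hy h hh]
  exact (h1 h hh).2

theorem freePart_eq_iInter :
    FreePart G = ⋂ g : G, ⋂ _ : g ≠ 1, {x : G → Bool | shiftMap g x ≠ x} := by
  ext x; simp [FreePart]

theorem isOpen_ne_shift (g : G) : IsOpen {x : G → Bool | shiftMap g x ≠ x} :=
  isOpen_ne_fun (shiftMap_continuous g) continuous_id

theorem freePart_measurable [Countable G] : MeasurableSet (FreePart G) := by
  rw [freePart_eq_iInter]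
  exact MeasurableSet.iInter fun g => MeasurableSet.iInter fun _ => (isOpen_ne_shift g).measurableSet

theorem freePart_residual [Countable G] [Infinite G] : FreePart G ∈ residual (G → Bool) := by
  rw [freePart_eq_iInter]
  refine countable_iInter_mem.2 fun g => countable_iInter_mem.2 fun hg => ?_
  refine residual_of_dense_open (isOpen_ne_shift g) ?_
  rw [dense_iff_inter_open]
  rintro U hU ⟨x, hx⟩
  obtain ⟨F, hF⟩ := isOpen_cyl hU hx
  classical
  obtain ⟨h, hh⟩ := Infinite.exists_notMem_finset F
  by_cases hc : shiftMap g x = x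
  · refine ⟨Function.update x h (!(x h)), hF _ fun l hl => ?_, ?_⟩
    · rw [Function.update_of_ne]; rintro rfl; exact hh hl
    · intro he
      have h1 := congrFun he h
      have h2 := congrFun hc h
      have hne : g⁻¹ * h ≠ h := by
        intro hgh
        apply hg
        have := mul_eq_right.1 hgh
        simpa using this
      simp only [shiftMap, Function.update_of_ne hne, Function.update_self] at h1 h2
      rw [h2] at h1
      simp at h1
  · exact ⟨x, hx, hc⟩

theorem meager_of_translates [Countable G] (g : ℕ → G) (hg : Function.Injective g)
    (B : Set (G → Bool)) (hB : MeasurableSet B)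
    (hdis : ∀ n x, x ∈ B → shiftMap (g n) x ∉ B) : Bᶜ ∈ residual (G → Bool) := by
  classical
  obtain ⟨U, hU, hBU⟩ := hB.residualEq_isOpen
  have hBU' : ∀ᶠ x in residual (G → Bool), (x ∈ B ↔ x ∈ U) := by
    filter_upwards [hBU] with x hx
    exact iff_of_eq hx
  by_cases hne : U.Nonempty
  · exfalso
    obtain ⟨x0, hx0⟩ := hne
    obtain ⟨F, hF⟩ := isOpen_cyl hU hx0
    obtain ⟨n, hn⟩ : ∃ n, g n ∉ (F ×ˢ F).image (fun p => p.1 * p.2⁻¹) := by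
      by_contra hall
      push Not at hall
      exact Set.infinite_of_injective_forall_mem hg hall (Finset.finite_toSet _)
    have hn' : ∀ h ∈ F, (g n)⁻¹ * h ∉ F := by
      intro h hh hh'
      apply hn
      rw [Finset.mem_image]
      exact ⟨(h, (g n)⁻¹ * h), Finset.mem_product.2 ⟨hh, hh'⟩, by simp⟩
    have hV : IsOpen (U ∩ shiftMap (g n) ⁻¹' U) := hU.inter (hU.preimage (shiftMap_continuous _))
    have hVne : (U ∩ shiftMap (g n) ⁻¹' U).Nonempty := by
      refine ⟨fun l => if l ∈ F then x0 l else x0 (g n * l), hF _ ?_, hF _ ?_⟩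
      · intro h hh; simp [hh]
      · intro h hh; simp [shiftMap, hn' h hh]
    have ht : Filter.Tendsto (shiftMap (g n)) (residual (G → Bool)) (residual (G → Bool)) :=
      tendsto_residual_of_isOpenMap (shiftMap_continuous _) (shiftHomeo (g n)).isOpenMap
    have hres : (U ∩ shiftMap (g n) ⁻¹' U)ᶜ ∈ residual (G → Bool) := by
      filter_upwards [hBU', ht.eventually hBU'] with x h1 h2 hx
      exact hdis n x (h1.2 hx.1) (h2.2 hx.2)
    obtain ⟨y, hy1, hy2⟩ := (dense_of_mem_residual hres).inter_open_nonempty _ hV hVne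
    exact hy2 hy1
  · rw [Set.not_nonempty_iff_eq_empty] at hne
    filter_upwards [hBU'] with x hx hxB
    have := hx.1 hxB
    rw [hne] at this
    exact this

/-- A Borel proper labelling by natural numbers. -/
theorem exists_label [Countable G] (S : Finset G) (hS : (1 : G) ∉ S) :
    ∃ ID : FreePart G → ℕ, Measurable ID ∧ ∀ s ∈ S, ∀ x, ID (s • x) ≠ ID x := by
  classical
  obtain ⟨e, he⟩ := exists_surjective_nat G
  let p : ℕ → FreePart G → Prop := fun n x => ∀ s ∈ S, ∃ i, i < n ∧ x.1 (e i) ≠ (s • x).1 (e i)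
  have hp : ∀ x, ∃ n, p n x := by
    intro x
    have h1 : ∀ s : G, ∃ i, s ∈ S → x.1 (e i) ≠ (s • x).1 (e i) := by
      intro s
      by_cases hs : s ∈ S
      · have hne : x ≠ s • x := (freePart_smul_ne s (fun h => hS (h ▸ hs)) x).symm
        have : x.1 ≠ (s • x).1 := fun h => hne (Subtype.ext h)
        obtain ⟨h, hh⟩ := Function.ne_iff.1 this
        obtain ⟨i, rfl⟩ := he h
        exact ⟨i, fun _ => hh⟩
      · exact ⟨0, fun h => absurd h hs⟩
    choose i hi using h1
    exact ⟨S.sup i + 1, fun s hs => ⟨i s, Nat.lt_succ_of_le (Finset.le_sup hs), hi s hs⟩⟩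
  have hev : ∀ h : G, Measurable (fun x : FreePart G => x.1 h) := fun h =>
    (measurable_pi_apply h).comp measurable_subtype_coe
  refine ⟨fun x => Encodable.encode (List.ofFn fun i : Fin (Nat.find (hp x)) => x.1 (e i)), ?_, ?_⟩
  · refine Measurable.find (f := fun n (x : FreePart G) =>
      Encodable.encode (List.ofFn fun i : Fin n => x.1 (e i))) (p := p) ?_ ?_ hp
    · intro n
      have h1 : Measurable (fun y : Fin n → Bool => Encodable.encode (List.ofFn y)) :=
        measurable_of_countable _
      have h2 : Measurable (fun (x : FreePart G) (i : Fin n) => x.1 (e i)) :=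
        measurable_pi_lambda _ fun i => hev _
      exact h1.comp h2
    · intro n
      apply measurableSet_setOfPred.2
      refine Measurable.forall fun s => Measurable.imp measurable_const
        (Measurable.exists fun i => Measurable.and measurable_const ?_)
      have : Measurable fun x : FreePart G => (x.1 (e i), (s • x).1 (e i)) :=
        (hev _).prodMk ((hev _).comp (freePart_smul_measurable s))
      exact (measurable_of_countable (fun y : Bool × Bool => y.1 ≠ y.2)).comp this
  · intro s hs x heq
    have h1 := Encodable.encode_injective heq
    have hlen := congrArg List.length h1
    simp only [List.length_ofFn] at hlen
    obtain ⟨i, hi, hne⟩ := Nat.find_spec (hp x) s hs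
    apply hne
    have h2 := congrArg (fun l => l[i]?) h1
    simp only [List.getElem?_ofFn, hi, hlen] at h2
    simpa using h2.symm

end Shift

/-! ### The infinite dihedral group -/

instance countableD2 : Countable D2 := by
  have : Countable (FreeMonoid (Multiplicative (ZMod 2) ⊕ Multiplicative (ZMod 2))) :=
    inferInstanceAs (Countable (List (Multiplicative (ZMod 2) ⊕ Multiplicative (ZMod 2))))
  exact (Monoid.Coprod.mk_surjective (M := Multiplicative (ZMod 2))
    (N := Multiplicative (ZMod 2))).countable

theorem genA_sq : genA * genA = 1 := by
  unfold genA
  rw [← map_mul]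
  exact map_one _

theorem genB_sq : genB * genB = 1 := by
  unfold genB
  rw [← map_mul]
  exact map_one _

/-- Rotation. -/
def rot : D2 := genB * genA

theorem genA_inv : genA⁻¹ = genA := inv_eq_of_mul_eq_one_left genA_sq
theorem genB_inv : genB⁻¹ = genB := inv_eq_of_mul_eq_one_left genB_sq

theorem rot_inv : rot⁻¹ = genA * genB := by
  rw [rot, mul_inv_rev, genA_inv, genB_inv]

theorem genA_rot : genA * rot = rot⁻¹ * genA := by
  rw [rot_inv, rot, mul_assoc]

theorem genA_rot_zpow (j : ℤ) : genA * rot ^ j = rot ^ (-j) * genA := by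
  have h : SemiconjBy genA rot rot⁻¹ := genA_rot
  have := (h.zpow_right j).eq
  rwa [inv_zpow, ← zpow_neg] at this

/-- The hom from the cyclic group of order two given by an involution. -/
def homOfInvol {H : Type*} [Group H] (σ : H) (h : σ * σ = 1) : Multiplicative (ZMod 2) →* H where
  toFun x := σ ^ (toAdd x).val
  map_one' := by simp
  map_mul' x y := by
    rw [← pow_add, toAdd_mul, ZMod.val_add]
    conv_rhs => rw [← Nat.div_add_mod ((toAdd x).val + (toAdd y).val) 2, pow_add, pow_mul, pow_two, h,
      one_pow, one_mul]

/-- The action on the integers, used to separate elements. -/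
def repD2 : D2 →* Equiv.Perm ℤ :=
  Monoid.Coprod.lift
    (homOfInvol (Equiv.subLeft (1 : ℤ)) (by ext n; simp))
    (homOfInvol (Equiv.subLeft (-1 : ℤ)) (by ext n; simp))

theorem repD2_A (n : ℤ) : repD2 genA n = 1 - n := by
  unfold repD2 genA
  rw [Monoid.Coprod.lift_apply_inl]
  show (Equiv.subLeft (1 : ℤ) ^ 1 : Equiv.Perm ℤ) n = _
  simp

theorem repD2_B (n : ℤ) : repD2 genB n = -1 - n := by
  unfold repD2 genB
  rw [Monoid.Coprod.lift_apply_inr]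
  show (Equiv.subLeft (-1 : ℤ) ^ 1 : Equiv.Perm ℤ) n = _
  simp

theorem repD2_rot (j n : ℤ) : repD2 (rot ^ j) n = n - 2 * j := by
  have h : ∀ n, repD2 rot n = n - 2 := by
    intro n
    rw [rot, map_mul, Equiv.Perm.mul_apply, repD2_A, repD2_B]
    ring
  have h' : ∀ n, repD2 rot⁻¹ n = n + 2 := by
    intro n
    have := h (n + 2)
    rw [add_sub_cancel_right] at this
    rw [map_inv, Equiv.Perm.inv_eq_iff_eq, this]
  induction j using Int.induction_on generalizing n with
  | zero => simp
  | succ j ih => rw [zpow_add_one, map_mul, Equiv.Perm.mul_apply, h, ih]; ring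
  | pred j ih => rw [zpow_sub_one, map_mul, Equiv.Perm.mul_apply, h', ih]; ring

theorem rot_zpow_ne_one (j : ℤ) (hj : j ≠ 0) : rot ^ j ≠ 1 := by
  intro h
  have := repD2_rot j 0
  rw [h] at this
  simp at this
  omega

theorem genA_rot_zpow_ne_one (j : ℤ) : genA * rot ^ j ≠ 1 := by
  intro h
  have := repD2_A (repD2 (rot ^ j) 0)
  rw [← Equiv.Perm.mul_apply, ← map_mul, h, repD2_rot] at this
  simp at this
  omega

theorem genA_rot_pow_injective : Function.Injective (fun m : ℕ => genA * rot ^ (m : ℤ)) := by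
  intro m n h
  have h1 := mul_left_cancel h
  have h2 := repD2_rot m 0
  rw [h1, repD2_rot] at h2
  omega

instance infiniteD2 : Infinite D2 := Infinite.of_injective _ genA_rot_pow_injective

theorem TK_eq1 (j : ℕ) : (genA * genB) ^ j = rot ^ (-(j : ℤ)) := by
  rw [← rot_inv, zpow_neg, zpow_natCast, inv_pow]

theorem TK_eq2 (j : ℕ) : (genB * genA) ^ j = rot ^ (j : ℤ) := by
  rw [zpow_natCast, rot]

theorem TK_eq3 (j : ℕ) : (genA * genB) ^ j * genA = genA * rot ^ (j : ℤ) := by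
  rw [TK_eq1, genA_rot_zpow]

theorem TK_eq4 (j : ℕ) : (genB * genA) ^ j * genB = genA * rot ^ (-(j + 1 : ℤ)) := by
  have : genB = rot * genA := by rw [rot, mul_assoc, genA_sq, mul_one]
  rw [TK_eq2, genA_rot_zpow, neg_neg, zpow_add_one, mul_assoc, ← this]

/-! ### Upper bound -/

theorem upper_D2 (k : ℕ) (hk : 3 ≤ k) : HasBorelColoring (ShiftAdj (TK' k)) (k + 1) := by
  obtain ⟨d, rfl⟩ : ∃ d, k = d + 1 := ⟨k - 1, by omega⟩
  let T : Equiv.Perm (FreePart D2) := MulAction.toPermHom D2 (FreePart D2) rot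
  let a : Equiv.Perm (FreePart D2) := MulAction.toPermHom D2 (FreePart D2) genA
  have hTj : ∀ (j : ℤ) x, (T ^ j) x = rot ^ j • x := by
    intro j x
    show ((MulAction.toPermHom D2 (FreePart D2) rot) ^ j) x = _
    rw [← map_zpow]; rfl
  have ha : ∀ x, a x = genA • x := fun x => rfl
  obtain ⟨col, hm, h1, h2⟩ := upper_abstract d T a (freePart_smul_measurable rot)
    (by
      have : Measurable (fun x : FreePart D2 => rot⁻¹ • x) := freePart_smul_measurable rot⁻¹
      convert this using 1
      funext x
      have := hTj (-1) x
      simpa using this)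
    (freePart_smul_measurable genA)
    (fun x => by rw [ha, ha, smul_smul, genA_sq, one_smul])
    (fun x => by
      have h1 := hTj 1 x
      have h2 := hTj (-1) (a x)
      rw [zpow_one, zpow_one] at h1
      rw [zpow_neg_one, zpow_neg_one] at h2
      rw [h1, h2, ha, ha, smul_smul, smul_smul, genA_rot])
    (by
      classical
      intro B
      obtain ⟨ID, i1, i2⟩ := exists_label (G := D2)
        (((Finset.Icc (-B : ℤ) B).filter (fun j => j ≠ 0)).image (fun j : ℤ => rot ^ j) ∪
          (Finset.Icc (-B : ℤ) B).image (fun j : ℤ => genA * rot ^ j)) (by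
          intro h
          rw [Finset.mem_union, Finset.mem_image, Finset.mem_image] at h
          rcases h with ⟨j, hj, h⟩ | ⟨j, hj, h⟩
          · exact rot_zpow_ne_one j (Finset.mem_filter.1 hj).2 h
          · exact genA_rot_zpow_ne_one j h)
      refine ⟨ID, i1, ?_, ?_⟩
      · intro x j h0 hj
        rw [hTj]
        rw [abs_le] at hj
        exact i2 _ (Finset.mem_union_left _ (Finset.mem_image.2
          ⟨j, Finset.mem_filter.2 ⟨Finset.mem_Icc.2 hj, h0⟩, rfl⟩)) x
      · intro x j hj
        rw [hTj, ha, smul_smul]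
        rw [abs_le] at hj
        exact i2 _ (Finset.mem_union_right _ (Finset.mem_image.2
          ⟨j, Finset.mem_Icc.2 hj, rfl⟩)) x)
  have h2' : ∀ (j : ℤ), j ≠ 0 → |j| ≤ d → ∀ x, col (rot ^ j • x) ≠ col x := by
    intro j h0 hj x
    rw [abs_le] at hj
    rcases lt_or_gt_of_ne h0 with h | h
    · have := h2 (rot ^ j • x) (-j) (by omega) (by omega)
      rw [hTj, smul_smul, ← zpow_add, neg_add_cancel, zpow_zero, one_smul] at this
      exact this.symm
    · rw [← hTj]; exact h2 x j (by omega) (by omega)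
  have h3' : ∀ (j : ℤ), j ≠ 0 → |j| ≤ d → ∀ x, col ((genA * rot ^ j) • x) ≠ col x := by
    intro j h0 hj x
    rw [mul_smul, ← ha, h1]
    exact h2' j h0 hj x
  refine ⟨col, hm, ?_⟩
  rintro x y ⟨-, s, ⟨j, hj1, hj2, hs⟩, hy⟩
  have hy' : y = s • x := Subtype.ext hy
  have hd : (j : ℤ) + 1 ≤ d := by omega
  rw [hy']
  rcases hs with rfl | rfl | rfl | rfl
  · rw [TK_eq1]; exact (h2' _ (by omega) (by rw [abs_le]; omega) x).symm
  · rw [TK_eq2]; exact (h2' _ (by omega) (by rw [abs_le]; omega) x).symm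
  · rw [TK_eq3]; exact (h3' _ (by omega) (by rw [abs_le]; omega) x).symm
  · rw [TK_eq4]; exact (h3' _ (by omega) (by rw [abs_le]; omega) x).symm

/-! ### Lower bound -/

/-- The element moving a point by `n` along its line. -/
noncomputable def lineElt (n : ℤ) : D2 := if Even n then rot ^ (n / 2) else genA * rot ^ (n / 2)

theorem lineElt_even (j : ℤ) : lineElt (2 * j) = rot ^ j := by
  rw [lineElt, if_pos (even_two_mul j)]
  congr 1; omega

theorem lineElt_odd (j : ℤ) : lineElt (2 * j + 1) = genA * rot ^ j := by
  rw [lineElt, if_neg (by rw [Int.not_even_iff_odd]; exact ⟨j, rfl⟩)]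
  congr 2; omega

theorem lineElt_flip (n m : ℤ) : lineElt n * (genA * rot ^ m) = lineElt (2 * m + 1 - n) := by
  rcases Int.even_or_odd' n with ⟨j, rfl | rfl⟩
  · have e : 2 * m + 1 - 2 * j = 2 * (m - j) + 1 := by ring
    rw [e, lineElt_even, lineElt_odd, genA_rot_zpow, genA_rot_zpow, ← mul_assoc, ← zpow_add]
    congr 2; ring
  · have e : 2 * m + 1 - (2 * j + 1) = 2 * (m - j) := by ring
    rw [e, lineElt_odd, lineElt_even, genA_rot_zpow, mul_assoc, ← mul_assoc genA, genA_sq, one_mul,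
      ← zpow_add]
    congr 1; ring

theorem TK_ne_one (k : ℕ) (s : D2) (hs : s ∈ TK' k) : s ≠ 1 := by
  obtain ⟨j, hj1, hj2, rfl | rfl | rfl | rfl⟩ := hs
  · rw [TK_eq1]; exact rot_zpow_ne_one _ (by omega)
  · rw [TK_eq2]; exact rot_zpow_ne_one _ (by omega)
  · rw [TK_eq3]; exact genA_rot_zpow_ne_one _
  · rw [TK_eq4]; exact genA_rot_zpow_ne_one _

theorem lineElt_adj (k : ℕ) (hk : 3 ≤ k) (i j : ℤ) (h1 : 2 ≤ j - i) (h2 : j - i ≤ 2 * k - 3) :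
    ∃ s ∈ TK' k, lineElt j = s * lineElt i := by
  rcases Int.even_or_odd' i with ⟨u, rfl | rfl⟩ <;> rcases Int.even_or_odd' j with ⟨v, rfl | rfl⟩
  · obtain ⟨t, ht⟩ : ∃ t : ℕ, v = u + t := ⟨(v - u).toNat, by omega⟩
    subst ht
    refine ⟨(genB * genA) ^ t, ⟨t, by omega, by omega, by simp⟩, ?_⟩
    rw [TK_eq2, lineElt_even, lineElt_even, ← zpow_add, add_comm]
  · obtain ⟨t, ht⟩ : ∃ t : ℕ, v = u + t := ⟨(v - u).toNat, by omega⟩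
    subst ht
    refine ⟨(genA * genB) ^ t * genA, ⟨t, by omega, by omega, by simp⟩, ?_⟩
    rw [TK_eq3, lineElt_even, lineElt_odd, mul_assoc, ← zpow_add, add_comm]
  · obtain ⟨t, ht⟩ : ∃ t : ℕ, v = u + t + 1 := ⟨(v - u - 1).toNat, by omega⟩
    subst ht
    refine ⟨(genB * genA) ^ t * genB, ⟨t, by omega, by omega, by simp⟩, ?_⟩
    rw [TK_eq4, lineElt_even, lineElt_odd, genA_rot_zpow, mul_assoc, ← mul_assoc genA, genA_sq,
      one_mul, ← zpow_add]
    congr 1; ring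
  · obtain ⟨t, ht⟩ : ∃ t : ℕ, v = u + t := ⟨(v - u).toNat, by omega⟩
    subst ht
    refine ⟨(genA * genB) ^ t, ⟨t, by omega, by omega, by simp⟩, ?_⟩
    rw [TK_eq1, lineElt_odd, lineElt_odd, genA_rot_zpow, genA_rot_zpow, ← mul_assoc, ← zpow_add]
    congr 2; ring

theorem lower_D2 (k : ℕ) (hk : 3 ≤ k) (c : FreePart D2 → Fin k) (hc : Measurable c)
    (hcol : ∀ x y, ShiftAdj (TK' k) x y → c x ≠ c y) : False := by
  have hprop : ∀ x : FreePart D2, ∀ i j : ℤ, 2 ≤ j - i → j - i ≤ 2 * k - 3 →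
      c (lineElt i • x) ≠ c (lineElt j • x) := by
    intro x i j h1 h2
    obtain ⟨s, hs, he⟩ := lineElt_adj k hk i j h1 h2
    apply hcol
    have e : lineElt j • x = s • lineElt i • x := by rw [he, mul_smul]
    rw [e]
    exact ⟨(freePart_smul_ne s (TK_ne_one k s hs) _).symm, s, hs, rfl⟩
  let B : Fin k → Fin k → Set (FreePart D2) := fun p q =>
    {x | ∃ n : ℤ, c (lineElt n • x) = p ∧ c (lineElt (n + 1) • x) = q}
  have hBm : ∀ p q, MeasurableSet (B p q) := by
    intro p q
    apply measurableSet_setOfPred.2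
    have h : ∀ n p, Measurable fun x => c (lineElt n • x) = p := fun n p =>
      (measurable_of_countable (fun y : Fin k => y = p)).comp
        (hc.comp (freePart_smul_measurable (lineElt n)))
    exact Measurable.exists fun n => (h n p).and (h (n + 1) q)
  have hres : ∀ p q, p ≠ q → (Subtype.val '' B p q)ᶜ ∈ residual (D2 → Bool) := by
    intro p q hpq
    refine meager_of_translates _ genA_rot_pow_injective _
      (freePart_measurable.subtype_image (hBm p q)) ?_
    rintro m _ ⟨x, ⟨n, h1, h2⟩, rfl⟩ ⟨y, ⟨n', h3, h4⟩, hy⟩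
    have hy' : y = (genA * rot ^ (m : ℤ)) • x := Subtype.ext hy
    rw [hy', smul_smul, lineElt_flip] at h3 h4
    refine lb_antisymm hk (fun i => c (lineElt i • x)) (hprop x) p q hpq n
      (2 * m + 1 - (n' + 1)) h1 h2 h4 ?_
    have e : (2 * m + 1 - (n' + 1) : ℤ) + 1 = 2 * m + 1 - n' := by ring
    simp only [e]
    exact h3
  have hall : (FreePart D2 ∩ ⋂ p : Fin k, ⋂ q : Fin k, ⋂ _ : p ≠ q, (Subtype.val '' B p q)ᶜ) ∈
      residual (D2 → Bool) :=
    Filter.inter_mem freePart_residual (countable_iInter_mem.2 fun p => countable_iInter_mem.2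
      fun q => countable_iInter_mem.2 fun hpq => hres p q hpq)
  obtain ⟨x, hx, hx2⟩ := (dense_of_mem_residual hall).nonempty
  have h02 := hprop ⟨x, hx⟩ 0 2 (by omega) (by omega)
  have hb : ∃ n : ℤ, c (lineElt n • ⟨x, hx⟩) ≠ c (lineElt (n + 1) • ⟨x, hx⟩) := by
    by_contra hcon
    push Not at hcon
    exact h02 ((hcon 0).trans (hcon 1))
  obtain ⟨n, hn⟩ := hb
  simp only [Set.mem_iInter] at hx2
  exact hx2 _ _ hn ⟨⟨x, hx⟩, ⟨n, rfl, rfl⟩, rfl⟩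

/-- For `k ≥ 3`, the Borel chromatic number of the shift graph of
`(ℤ/2ℤ * ℤ/2ℤ, T'_k)` equals `k + 1`. -/
theorem borelChromatic_shift_DeltaK' (k : ℕ) (hk : 3 ≤ k) :
    borelChromatic (ShiftAdj (TK' k)) = k + 1 := by
  apply le_antisymm
  · exact Nat.sInf_le (upper_D2 k hk)
  · refine le_csInf ⟨_, upper_D2 k hk⟩ ?_
    rintro n ⟨c, hc, hcol⟩
    by_contra hlt
    have hnk : n ≤ k := by omega
    refine lower_D2 k hk (fun x => Fin.castLE hnk (c x))
      ((measurable_of_countable (Fin.castLE hnk)).comp hc) fun x y hxy he => hcol x y hxy ?_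
    exact Fin.castLE_injective hnk he
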